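/- arXiv:2505.02070 — 4 statements merged into one kernel-verified Lean document; each statement's English description precedes it below -/
import Mathlib

section
/- The extended total energy E is lower semicontinuous on ℝ × ℝ^d × ℝ as a function with values in [0,∞]: at every point x₀, liminf_{x → x₀} E(x) ≥ E(x₀). -/
open Real

open scoped ENNReal Classical

/-- The extended total energy of the polytropic Euler system, as a `[0,∞]`-valued
function of `(ρ, m, S) ∈ ℝ × ℝ^d × ℝ`. -/
noncomputable def energyE (d : ℕ) (γ : ℝ) (x : ℝ × EuclideanSpace ℝ (Fin d) × ℝ) : ℝ≥0∞ :=
  if 0 < x.1 then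
    ENNReal.ofReal
      (‖x.2.1‖ ^ 2 / (2 * x.1) + (γ - 1)⁻¹ * x.1 ^ γ * Real.exp ((γ - 1) * x.2.2 / x.1))
  else if x.1 = 0 ∧ x.2.1 = 0 ∧ x.2.2 ≤ 0 then 0
  else ⊤

/-- The pressure potential with entropy bounded below by `s > 0` blows up at the vacuum. -/
theorem tendsto_rpow_mul_exp_div_nhdsGT_zero (γ : ℝ) {a : ℝ} (ha : 0 < a) :
    Filter.Tendsto (fun r : ℝ => r ^ γ * Real.exp (a / r)) (nhdsWithin 0 (Set.Ioi 0))
      Filter.atTop := by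
  refine ((tendsto_exp_mul_div_rpow_atTop γ a ha).comp tendsto_inv_nhdsGT_zero).congr' ?_
  filter_upwards [self_mem_nhdsWithin] with r hr
  have hr : 0 < r := hr
  simp only [Function.comp_apply]
  rw [Real.inv_rpow hr.le, div_inv_eq_mul, div_eq_mul_inv a r, mul_comm]

theorem energyE_of_pos {d : ℕ} {γ : ℝ} {x : ℝ × EuclideanSpace ℝ (Fin d) × ℝ} (hx : 0 < x.1) :
    energyE d γ x = ENNReal.ofReal
      (‖x.2.1‖ ^ 2 / (2 * x.1) + (γ - 1)⁻¹ * x.1 ^ γ * Real.exp ((γ - 1) * x.2.2 / x.1)) :=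
  if_pos hx

theorem energyE_eq_top {d : ℕ} {γ : ℝ} {x : ℝ × EuclideanSpace ℝ (Fin d) × ℝ} (hx : ¬ 0 < x.1)
    (h : ¬ (x.1 = 0 ∧ x.2.1 = 0 ∧ x.2.2 ≤ 0)) : energyE d γ x = ⊤ := by
  rw [energyE, if_neg hx, if_neg h]

theorem continuousAt_energyE_of_pos {d : ℕ} {γ : ℝ} {x : ℝ × EuclideanSpace ℝ (Fin d) × ℝ}
    (hx : 0 < x.1) : ContinuousAt (energyE d γ) x := by
  have hev : ∀ᶠ z : ℝ × EuclideanSpace ℝ (Fin d) × ℝ in nhds x, 0 < z.1 :=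
    continuous_fst.continuousAt.eventually (lt_mem_nhds hx)
  refine ContinuousAt.congr ?_ (hev.mono fun z hz => (energyE_of_pos hz).symm)
  refine ENNReal.continuous_ofReal.continuousAt.comp ?_
  have h1 : ContinuousAt (fun z : ℝ × EuclideanSpace ℝ (Fin d) × ℝ => z.1) x :=
    continuous_fst.continuousAt
  have hpow := h1.rpow_const (p := γ) (Or.inl hx.ne')
  have hkin : ContinuousAt
      (fun z : ℝ × EuclideanSpace ℝ (Fin d) × ℝ => ‖z.2.1‖ ^ 2 / (2 * z.1)) x :=
    ContinuousAt.div (by fun_prop) (by fun_prop) (by positivity)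
  have hquot : ContinuousAt
      (fun z : ℝ × EuclideanSpace ℝ (Fin d) × ℝ => (γ - 1) * z.2.2 / z.1) x :=
    ContinuousAt.div (by fun_prop) h1 hx.ne'
  exact hkin.add ((continuousAt_const.mul hpow).mul hquot.rexp)

/-- Near a vacuum state, a lower bound by a function of the density that blows up at the vacuum
makes the energy exceed every finite value. -/
theorem eventually_lt_energyE_of_tendsto_atTop {d : ℕ} {γ : ℝ}
    {x : ℝ × EuclideanSpace ℝ (Fin d) × ℝ} (hx : x.1 = 0) {g : ℝ → ℝ}
    (hg : Filter.Tendsto g (nhdsWithin 0 (Set.Ioi 0)) Filter.atTop)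
    (hle : ∀ᶠ z in nhds x, 0 < z.1 → ENNReal.ofReal (g z.1) ≤ energyE d γ z)
    (htop : ∀ᶠ z in nhds x, ¬ 0 < z.1 → energyE d γ z = ⊤)
    {y : ℝ≥0∞} (hy : y < ⊤) : ∀ᶠ z in nhds x, y < energyE d γ z := by
  have hlarge := eventually_nhdsWithin_iff.1 (hg.eventually_gt_atTop y.toReal)
  rw [← hx] at hlarge
  filter_upwards [continuous_fst.continuousAt.eventually hlarge, hle, htop] with z h₁ h₂ h₃
  by_cases hz : 0 < z.1
  · exact ((ENNReal.lt_ofReal_iff_toReal_lt hy.ne).2 (h₁ (hx.trans_lt hz))).trans_le (h₂ hz)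
  · rwa [h₃ hz]

/-- The extended total energy is lower semicontinuous on `ℝ × ℝ^d × ℝ`
as a `[0,∞]`-valued function. -/
theorem energyE_lowerSemicontinuous (d : ℕ) (hd : 1 ≤ d) (γ : ℝ) (hγ : 1 < γ) :
    LowerSemicontinuous (energyE d γ) := by
  intro x y hy
  rcases lt_trichotomy x.1 0 with hx | hx | hx
  · have hev : ∀ᶠ z : ℝ × EuclideanSpace ℝ (Fin d) × ℝ in nhds x, z.1 < 0 :=
      continuous_fst.continuousAt.eventually (gt_mem_nhds hx)
    filter_upwards [hev] with z hz
    rw [energyE_eq_top hz.not_gt fun h => hz.ne h.1]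
    exact hy.trans_le le_top
  · have hγ' : 0 < γ - 1 := sub_pos.2 hγ
    have hy' : y < ⊤ := hy.trans_le le_top
    by_cases hm : x.2.1 = 0
    · rcases le_or_gt x.2.2 0 with hS | hS
      · simp [energyE, hx, hm, hS] at hy
      · have hev : ∀ᶠ z : ℝ × EuclideanSpace ℝ (Fin d) × ℝ in nhds x, x.2.2 / 2 < z.2.2 :=
          (continuous_snd.comp continuous_snd).continuousAt.eventually
            (lt_mem_nhds (half_lt_self hS))
        refine eventually_lt_energyE_of_tendsto_atTop hx
          ((tendsto_rpow_mul_exp_div_nhdsGT_zero γ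
            (mul_pos hγ' (half_pos hS))).const_mul_atTop (inv_pos.2 hγ')) ?_ ?_ hy'
        · filter_upwards [hev] with z hz hz0
          rw [energyE_of_pos hz0, ← mul_assoc]
          refine ENNReal.ofReal_le_ofReal (le_add_of_nonneg_of_le (by positivity) ?_)
          gcongr
        · filter_upwards [hev] with z hz hz0
          exact energyE_eq_top hz0 fun h => by linarith [h.2.2]
    · have hnorm : 0 < ‖x.2.1‖ := norm_pos_iff.2 hm
      have hev : ∀ᶠ z : ℝ × EuclideanSpace ℝ (Fin d) × ℝ in nhds x, ‖x.2.1‖ / 2 < ‖z.2.1‖ :=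
        (continuous_norm.comp (continuous_fst.comp continuous_snd)).continuousAt.eventually
          (lt_mem_nhds (half_lt_self hnorm))
      refine eventually_lt_energyE_of_tendsto_atTop hx
        (tendsto_inv_nhdsGT_zero.const_mul_atTop
          (show 0 < (‖x.2.1‖ / 2) ^ 2 / 2 by positivity)) ?_ ?_ hy'
      · filter_upwards [hev] with z hz hz0
        rw [energyE_of_pos hz0, ← div_eq_mul_inv, div_div]
        refine ENNReal.ofReal_le_ofReal (le_add_of_le_of_nonneg ?_ (by positivity))
        gcongr
      · filter_upwards [hev] with z hz hz0
        refine energyE_eq_top hz0 fun h => ?_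
        rw [h.2.1, norm_zero] at hz
        linarith
  · exact (continuousAt_energyE_of_pos hx).lowerSemicontinuousAt y hy
end

section
/- The extended internal energy density H : ℝ² → [0,∞], defined by H(ρ, S) = (γ−1)⁻¹ ρ^γ exp((γ−1)S/ρ) if ρ > 0, H(ρ, S) = 0 if ρ = 0 and S ≤ 0, and H(ρ, S) = +∞ otherwise (i.e. if ρ < 0, or ρ = 0 and S > 0), is both convex and lower semicontinuous on ℝ² as a [0,∞]-valued function. -/
open Real

open scoped ENNReal Classical

/-- The extended internal energy density `H : ℝ² → [0,∞]` of the polytropic Euler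
system: `H(ρ, S) = (γ−1)⁻¹ ρ^γ exp((γ−1)S/ρ)` for `ρ > 0`, `0` on the vacuum states
`{ρ = 0, S ≤ 0}`, and `+∞` elsewhere. -/
noncomputable def internalEnergyE (γ : ℝ) (p : ℝ × ℝ) : ℝ≥0∞ :=
  if 0 < p.1 then ENNReal.ofReal ((γ - 1)⁻¹ * p.1 ^ γ * Real.exp ((γ - 1) * p.2 / p.1))
  else if p.1 = 0 ∧ p.2 ≤ 0 then 0
  else ⊤

/-- The affine minorants of `internalEnergyE γ`, obtained by bounding `exp` and `ρ * log ρ`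
from below by their tangents at `a` and `exp b`. -/
noncomputable def internalEnergyMinorant (γ a b : ℝ) (p : ℝ × ℝ) : ℝ :=
  (γ - 1)⁻¹ * (exp a * (p.1 * (1 - a) + (γ - 1) * (p.1 * (1 + b) - exp b + p.2)))

lemma continuous_internalEnergyMinorant (γ a b : ℝ) :
    Continuous (internalEnergyMinorant γ a b) := by
  unfold internalEnergyMinorant
  fun_prop

lemma internalEnergyMinorant_convexComb (γ a b t : ℝ) (p q : ℝ × ℝ) :
    internalEnergyMinorant γ a b (t • p + (1 - t) • q) =
      t * internalEnergyMinorant γ a b p + (1 - t) * internalEnergyMinorant γ a b q := by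
  simp only [internalEnergyMinorant, Prod.fst_add, Prod.snd_add, Prod.smul_fst, Prod.smul_snd,
    smul_eq_mul]
  ring

lemma rpow_mul_exp_eq_mul_exp {γ r s : ℝ} (hr : 0 < r) :
    r ^ γ * exp ((γ - 1) * s / r) = r * exp ((γ - 1) * (log r + s / r)) := by
  have h : r * exp ((γ - 1) * (log r + s / r)) =
      exp (log r) * exp ((γ - 1) * (log r + s / r)) := by
    rw [exp_log hr]
  rw [h, rpow_def_of_pos hr, ← exp_add, ← exp_add]
  congr 1
  ring

lemma internalEnergyMinorant_le {γ : ℝ} (hγ : 1 < γ) (a b : ℝ) {r s : ℝ} (hr : 0 < r) :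
    internalEnergyMinorant γ a b (r, s) ≤
      (γ - 1)⁻¹ * (r * exp ((γ - 1) * (log r + s / r))) := by
  have hc : 0 < γ - 1 := by linarith
  unfold internalEnergyMinorant
  refine mul_le_mul_of_nonneg_left ?_ (inv_nonneg.2 hc.le)
  have hlog : r * (1 + b) - exp b ≤ r * log r := by
    have h := add_one_le_exp (b - log r)
    rw [exp_sub, exp_log hr, le_div_iff₀ hr] at h
    linarith
  set u := (γ - 1) * (log r + s / r) with hu
  have hru : r * u = (γ - 1) * (r * log r + s) := by
    rw [hu]
    field_simp
  have hexp : exp a * (1 + u - a) ≤ exp u := by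
    have h := mul_le_mul_of_nonneg_left (add_one_le_exp (u - a)) (exp_pos a).le
    rw [← exp_add, add_sub_cancel] at h
    linarith
  calc exp a * (r * (1 - a) + (γ - 1) * (r * (1 + b) - exp b + s))
      ≤ exp a * (r * (1 - a) + (γ - 1) * (r * log r + s)) := by gcongr
    _ = r * (exp a * (1 + u - a)) := by rw [← hru]; ring
    _ ≤ r * exp u := by gcongr

lemma internalEnergyMinorant_eq (γ : ℝ) {r s : ℝ} (hr : 0 < r) :
    internalEnergyMinorant γ ((γ - 1) * (log r + s / r)) (log r) (r, s) =
      (γ - 1)⁻¹ * (r * exp ((γ - 1) * (log r + s / r))) := by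
  simp only [internalEnergyMinorant, exp_log hr]
  field_simp
  ring

lemma exists_le_internalEnergyMinorant {γ : ℝ} (hγ : 1 < γ) {r s : ℝ}
    (h : r < 0 ∨ r = 0 ∧ 0 < s) {M : ℝ} (hM : 0 < M) :
    ∃ a b, M ≤ internalEnergyMinorant γ a b (r, s) := by
  have hc : 0 < γ - 1 := by linarith
  rcases h with hr | ⟨rfl, hs⟩
  · set K := |(γ - 1) * M - r - (γ - 1) * (r - 1 + s)| with hK
    refine ⟨K / -r, 0, ?_⟩
    have ha : 0 ≤ K / -r := div_nonneg (abs_nonneg _) (by linarith)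
    have hra : r * (K / -r) = -K := by
      rw [div_neg, mul_neg, mul_div_cancel₀ _ hr.ne]
    have hle := le_abs_self ((γ - 1) * M - r - (γ - 1) * (r - 1 + s))
    rw [← hK] at hle
    have hbr : (γ - 1) * M ≤
        r * (1 - K / -r) + (γ - 1) * (r * (1 + 0) - exp 0 + s) := by
      rw [mul_sub, hra, exp_zero]
      linarith
    unfold internalEnergyMinorant
    rw [le_inv_mul_iff₀ hc]
    exact hbr.trans (le_mul_of_one_le_left ((mul_pos hc hM).le.trans hbr) (one_le_exp ha))
  · refine ⟨log (2 * M / s), log (s / 2), ?_⟩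
    simp only [internalEnergyMinorant]
    rw [exp_log (by positivity), exp_log (by positivity)]
    refine le_of_eq ?_
    field_simp
    ring

lemma internalEnergyE_eq_iSup {γ : ℝ} (hγ : 1 < γ) (p : ℝ × ℝ) :
    internalEnergyE γ p = ⨆ a, ⨆ b, ENNReal.ofReal (internalEnergyMinorant γ a b p) := by
  obtain ⟨r, s⟩ := p
  have hc : 0 < γ - 1 := by linarith
  simp only [internalEnergyE]
  split_ifs with hr hv
  · rw [mul_assoc, rpow_mul_exp_eq_mul_exp hr]
    refine le_antisymm ?_ (iSup₂_le fun a b =>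
      ENNReal.ofReal_le_ofReal (internalEnergyMinorant_le hγ a b hr))
    rw [← internalEnergyMinorant_eq γ hr]
    exact le_iSup₂ (f := fun a b => ENNReal.ofReal (internalEnergyMinorant γ a b (r, s))) _ _
  · obtain ⟨rfl, hs⟩ := hv
    refine (le_antisymm (iSup₂_le fun a b => ?_) bot_le).symm
    refine (ENNReal.ofReal_eq_zero.2 ?_).le
    simp only [internalEnergyMinorant, zero_mul, zero_add, zero_sub]
    have hneg : (γ - 1) * (-exp b + s) ≤ 0 :=
      mul_nonpos_of_nonneg_of_nonpos hc.le (by linarith [exp_pos b])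
    exact mul_nonpos_of_nonneg_of_nonpos (inv_nonneg.2 hc.le)
      (mul_nonpos_of_nonneg_of_nonpos (exp_pos a).le hneg)
  · have h : r < 0 ∨ r = 0 ∧ 0 < s := by
      rcases (not_lt.1 hr).lt_or_eq with h | h
      · exact Or.inl h
      · exact Or.inr ⟨h, not_le.1 fun hs => hv ⟨h, hs⟩⟩
    refine (ENNReal.eq_top_of_forall_nnreal_le fun x => ?_).symm
    obtain ⟨a, b, hab⟩ := exists_le_internalEnergyMinorant hγ h
      (add_pos_of_nonneg_of_pos x.coe_nonneg one_pos)
    refine le_trans ?_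
      (le_iSup₂ (f := fun a b => ENNReal.ofReal (internalEnergyMinorant γ a b (r, s))) a b)
    rw [← ENNReal.ofReal_coe_nnreal]
    exact ENNReal.ofReal_le_ofReal (by linarith)

/-- The extended internal energy density is convex and lower semicontinuous on `ℝ²`
as a `[0,∞]`-valued function. -/
theorem internalEnergyE_convex_lowerSemicontinuous (γ : ℝ) (hγ : 1 < γ) :
    (∀ p q : ℝ × ℝ, ∀ t : ℝ, 0 ≤ t → t ≤ 1 →
      internalEnergyE γ (t • p + (1 - t) • q)
        ≤ ENNReal.ofReal t * internalEnergyE γ p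
          + ENNReal.ofReal (1 - t) * internalEnergyE γ q) ∧
    LowerSemicontinuous (internalEnergyE γ) := by
  constructor
  · intro p q t ht0 ht1
    have ht1' : 0 ≤ 1 - t := sub_nonneg.2 ht1
    simp only [internalEnergyE_eq_iSup hγ]
    refine iSup₂_le fun a b => ?_
    rw [internalEnergyMinorant_convexComb]
    refine ENNReal.ofReal_add_le.trans ?_
    rw [ENNReal.ofReal_mul ht0, ENNReal.ofReal_mul ht1']
    gcongr
    · exact le_iSup₂ (f := fun a b => ENNReal.ofReal (internalEnergyMinorant γ a b p)) a b
    · exact le_iSup₂ (f := fun a b => ENNReal.ofReal (internalEnergyMinorant γ a b q)) a b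
  · rw [funext (internalEnergyE_eq_iSup hγ)]
    exact lowerSemicontinuous_iSup fun a => lowerSemicontinuous_iSup fun b =>
      (ENNReal.continuous_ofReal.comp
        (continuous_internalEnergyMinorant γ a b)).lowerSemicontinuous
end

section
/- (Vanishing oscillation defect forces a Dirac measure.) Let ν be a Borel probability measure on ℝ × ℝ^d × ℝ giving full measure to the set {(ρ, m, S) : ρ > 0}, and assume that the coordinate functions (ρ, m, S) ↦ ρ, (ρ, m, S) ↦ m, (ρ, m, S) ↦ S, and the energy (ρ, m, S) ↦ E(ρ, m, S) are all ν-integrable. Set ρ̄ = ∫ ρ dν, m̄ = ∫ m dν, S̄ = ∫ S dν; then ρ̄ > 0, the Jensen inequality ∫ E dν ≥ E(ρ̄, m̄, S̄) holds, and if moreover ∫ E dν ≤ E(ρ̄, m̄, S̄), then ν is the Dirac measure concentrated at (ρ̄, m̄, S̄). -/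
open Real MeasureTheory

open scoped ENNReal Classical

/-- The total energy of the polytropic Euler system on the region `ρ > 0`, as a real number. -/
noncomputable def realEnergy (d : ℕ) (γ : ℝ) (x : ℝ × EuclideanSpace ℝ (Fin d) × ℝ) : ℝ :=
  ‖x.2.1‖ ^ 2 / (2 * x.1) + (γ - 1)⁻¹ * x.1 ^ γ * Real.exp ((γ - 1) * x.2.2 / x.1)

/-- The first-order Taylor polynomial of `realEnergy` at the base point `b`. -/
noncomputable def energyTangent (d : ℕ) (γ : ℝ) (b x : ℝ × EuclideanSpace ℝ (Fin d) × ℝ) : ℝ :=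
  (inner ℝ b.2.1 x.2.1 / b.1 - x.1 * (‖b.2.1‖ ^ 2 / (2 * b.1 ^ 2))) +
    (γ - 1)⁻¹ * (Real.exp ((γ - 1) * (Real.log b.1 + b.2.2 / b.1)) *
      (x.1 + (γ - 1) * (x.1 - b.1 + x.2.2 - x.1 * (b.2.2 / b.1))))

theorem kinetic_eq_tangent_add_sq {F : Type*} [NormedAddCommGroup F] [InnerProductSpace ℝ F]
    {r ρ : ℝ} (hr : 0 < r) (hρ : 0 < ρ) (M m : F) :
    ‖m‖ ^ 2 / (2 * ρ) = inner ℝ M m / r - ρ * (‖M‖ ^ 2 / (2 * r ^ 2)) +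
      ‖r • m - ρ • M‖ ^ 2 / (2 * ρ * r ^ 2) := by
  rw [norm_sub_sq_real, norm_smul, norm_smul, inner_smul_left, inner_smul_right,
    real_inner_comm, Real.norm_of_nonneg hr.le, Real.norm_of_nonneg hρ.le]
  simp only [conj_trivial]
  field_simp
  ring

theorem rpow_mul_exp_eq {γ ρ : ℝ} (hρ : 0 < ρ) (S : ℝ) :
    ρ ^ γ * Real.exp ((γ - 1) * S / ρ) =
      ρ * Real.exp ((γ - 1) * (Real.log ρ + S / ρ)) := by
  rw [Real.rpow_def_of_pos hρ, ← Real.exp_add]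
  nth_rw 3 [← Real.exp_log hρ]
  rw [← Real.exp_add]
  congr 1
  ring

theorem mul_log_tangent_lt {r ρ : ℝ} (hr : 0 < r) (hρ : 0 < ρ) (h : ρ ≠ r) :
    ρ * Real.log r + ρ - r < ρ * Real.log ρ := by
  have h1 : Real.log (r / ρ) < r / ρ - 1 :=
    Real.log_lt_sub_one_of_pos (by positivity) fun h' => h ((div_eq_one_iff_eq hρ.ne').1 h').symm
  rw [Real.log_div hr.ne' hρ.ne'] at h1
  have h2 := mul_lt_mul_of_pos_left h1 hρ
  have h3 : ρ * (r / ρ - 1) = r - ρ := by field_simp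
  rw [h3] at h2
  linarith

theorem pressure_tangent_lt {k r ρ : ℝ} (hk : 0 < k) (hr : 0 < r) (hρ : 0 < ρ) (s S : ℝ)
    (h : ¬ (ρ = r ∧ S = s)) :
    Real.exp (k * (Real.log r + s / r)) * (ρ + k * (ρ - r + S - ρ * (s / r))) <
      ρ * Real.exp (k * (Real.log ρ + S / ρ)) := by
  set a := k * (Real.log r + s / r) with ha
  set b := k * (Real.log ρ + S / ρ) with hb
  have hab : ρ * (b - a) = k * (ρ * Real.log ρ - ρ * Real.log r + S - ρ * (s / r)) := by
    rw [ha, hb]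
    field_simp
    ring
  have hexp : Real.exp b = Real.exp a * Real.exp (b - a) := by
    rw [← Real.exp_add]
    congr 1
    ring
  rw [hexp, mul_left_comm]
  refine mul_lt_mul_of_pos_left ?_ (Real.exp_pos a)
  by_cases hρr : ρ = r
  · subst hρr
    have hSs : S ≠ s := fun h' => h ⟨rfl, h'⟩
    have hne : b - a ≠ 0 := by
      intro h0
      rw [h0, mul_zero, mul_div_cancel₀ _ hρ.ne'] at hab
      have := (mul_eq_zero.1 hab.symm).resolve_left hk.ne'
      exact hSs (by linarith)
    have h1 := mul_lt_mul_of_pos_left (Real.add_one_lt_exp hne) hρ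
    nlinarith
  · have h1 := mul_le_mul_of_nonneg_left (Real.add_one_le_exp (b - a)) hρ.le
    have h2 := mul_lt_mul_of_pos_left (mul_log_tangent_lt hr hρ hρr) hk
    nlinarith

theorem energyTangent_self (d : ℕ) (γ : ℝ) {b : ℝ × EuclideanSpace ℝ (Fin d) × ℝ}
    (hb : 0 < b.1) : energyTangent d γ b b = realEnergy d γ b := by
  rw [realEnergy, energyTangent, mul_assoc, rpow_mul_exp_eq hb, real_inner_self_eq_norm_sq]
  field_simp
  ring

theorem energyTangent_lt_realEnergy (d : ℕ) {γ : ℝ} (hγ : 1 < γ)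
    {b x : ℝ × EuclideanSpace ℝ (Fin d) × ℝ} (hb : 0 < b.1) (hx : 0 < x.1) (h : x ≠ b) :
    energyTangent d γ b x < realEnergy d γ x := by
  obtain ⟨r, M, s⟩ := b
  obtain ⟨ρ, m, S⟩ := x
  simp only at hb hx
  have hk : 0 < γ - 1 := sub_pos.2 hγ
  have hk' : 0 < (γ - 1)⁻¹ := inv_pos.2 hk
  simp only [realEnergy, energyTangent]
  rw [mul_assoc _ (ρ ^ γ), rpow_mul_exp_eq hx, kinetic_eq_tangent_add_sq hb hx M m]
  by_cases hc : ρ = r ∧ S = s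
  · obtain ⟨rfl, rfl⟩ := hc
    have hne : m - M ≠ 0 := fun h' => h (by rw [sub_eq_zero.1 h'])
    have : 0 < ‖ρ • m - ρ • M‖ ^ 2 / (2 * ρ * ρ ^ 2) := by
      rw [← smul_sub]
      have : 0 < ‖ρ • (m - M)‖ := norm_pos_iff.2 (smul_ne_zero hx.ne' hne)
      positivity
    have h2 : Real.exp ((γ - 1) * (Real.log ρ + S / ρ)) *
        (ρ + (γ - 1) * (ρ - ρ + S - ρ * (S / ρ))) =
        ρ * Real.exp ((γ - 1) * (Real.log ρ + S / ρ)) := by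
      field_simp
      ring
    rw [h2]
    linarith
  · have h1 := mul_lt_mul_of_pos_left (pressure_tangent_lt hk hb hx s S hc) hk'
    have h2 : 0 ≤ ‖r • m - ρ • M‖ ^ 2 / (2 * ρ * r ^ 2) := by positivity
    linarith

theorem energyTangent_le_realEnergy (d : ℕ) {γ : ℝ} (hγ : 1 < γ)
    {b x : ℝ × EuclideanSpace ℝ (Fin d) × ℝ} (hb : 0 < b.1) (hx : 0 < x.1) :
    energyTangent d γ b x ≤ realEnergy d γ x := by
  by_cases h : x = b
  · rw [h, energyTangent_self d γ hb]
  · exact (energyTangent_lt_realEnergy d hγ hb hx h).le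

theorem energyE_of_pos_s9 (d : ℕ) (γ : ℝ) {x : ℝ × EuclideanSpace ℝ (Fin d) × ℝ} (hx : 0 < x.1) :
    energyE d γ x = ENNReal.ofReal (realEnergy d γ x) := if_pos hx

theorem realEnergy_nonneg (d : ℕ) {γ : ℝ} (hγ : 1 < γ)
    {x : ℝ × EuclideanSpace ℝ (Fin d) × ℝ} (hx : 0 < x.1) : 0 ≤ realEnergy d γ x := by
  have : 0 < γ - 1 := sub_pos.2 hγ
  unfold realEnergy
  positivity

theorem measurable_realEnergy (d : ℕ) (γ : ℝ) : Measurable (realEnergy d γ) := by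
  unfold realEnergy
  fun_prop

section Tangent

variable {d : ℕ} {ν : Measure (ℝ × EuclideanSpace ℝ (Fin d) × ℝ)}

theorem integrable_energyTangent [IsFiniteMeasure ν] (γ : ℝ)
    (b : ℝ × EuclideanSpace ℝ (Fin d) × ℝ) (hρ : Integrable (fun p => p.1) ν)
    (hm : Integrable (fun p => p.2.1) ν) (hS : Integrable (fun p => p.2.2) ν) :
    Integrable (energyTangent d γ b) ν :=
  (((hm.const_inner b.2.1).div_const _).sub (hρ.mul_const _)).add
    (((hρ.add ((((hρ.sub (integrable_const b.1)).add hS).sub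
      (hρ.mul_const _)).const_mul _)).const_mul _).const_mul _)

theorem integral_energyTangent [IsProbabilityMeasure ν] (γ : ℝ)
    (b : ℝ × EuclideanSpace ℝ (Fin d) × ℝ) (hρ : Integrable (fun p => p.1) ν)
    (hm : Integrable (fun p => p.2.1) ν) (hS : Integrable (fun p => p.2.2) ν) :
    ∫ p, energyTangent d γ b p ∂ν =
      energyTangent d γ b (∫ p, p.1 ∂ν, ∫ p, p.2.1 ∂ν, ∫ p, p.2.2 ∂ν) := by
  have hc := integrable_const (μ := ν) b.1
  have h1 := (hm.const_inner (𝕜 := ℝ) b.2.1).div_const b.1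
  have h2 := hρ.mul_const (‖b.2.1‖ ^ 2 / (2 * b.1 ^ 2))
  have h3 := hρ.mul_const (b.2.2 / b.1)
  have h12 : Integrable (fun p => inner ℝ b.2.1 p.2.1 / b.1 -
      p.1 * (‖b.2.1‖ ^ 2 / (2 * b.1 ^ 2))) ν := h1.sub h2
  have h4 : Integrable (fun p => p.1 - b.1) ν := hρ.sub hc
  have h5 : Integrable (fun p => p.1 - b.1 + p.2.2) ν := h4.add hS
  have h6 : Integrable (fun p => (γ - 1) * (p.1 - b.1 + p.2.2 - p.1 * (b.2.2 / b.1))) ν :=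
    (h5.sub h3).const_mul _
  have h7 : Integrable (fun p => (γ - 1)⁻¹ *
      (Real.exp ((γ - 1) * (Real.log b.1 + b.2.2 / b.1)) *
        (p.1 + (γ - 1) * (p.1 - b.1 + p.2.2 - p.1 * (b.2.2 / b.1))))) ν :=
    ((hρ.add h6).const_mul _).const_mul _
  simp only [energyTangent]
  rw [integral_add h12 h7, integral_sub h1 h2, integral_const_mul, integral_const_mul,
    integral_add hρ h6, integral_const_mul, integral_sub h5 h3, integral_add h4 hS,
    integral_sub hρ hc, integral_div, integral_mul_const, integral_mul_const, integral_inner hm]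
  simp

end Tangent

theorem eq_dirac_of_ae_eq {α : Type*} [MeasurableSpace α] {μ : Measure α}
    [IsProbabilityMeasure μ] {a : α} (h : ∀ᵐ x ∂μ, x = a) : μ = Measure.dirac a := by
  have h1 : μ.map id = μ.map fun _ => a := Measure.map_congr h
  simpa [Measure.map_const] using h1

/-- Vanishing oscillation defect forces a Dirac measure: if `ν` is a probability
measure concentrated on `{ρ > 0}` with integrable coordinates and integrable energy,
then `ρ̄ = ∫ ρ dν > 0`, the Jensen inequality `∫ E dν ≥ E(ρ̄, m̄, S̄)` holds, and
saturation of the Jensen inequality forces `ν` to be the Dirac mass at `(ρ̄, m̄, S̄)`. -/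
theorem oscillation_defect_zero_dirac (d : ℕ) (hd : 1 ≤ d) (γ : ℝ) (hγ : 1 < γ)
    (ν : Measure (ℝ × EuclideanSpace ℝ (Fin d) × ℝ)) [IsProbabilityMeasure ν]
    (hpos : ν {p | 0 < p.1} = 1)
    (hρ : Integrable (fun p => p.1) ν)
    (hm : Integrable (fun p => p.2.1) ν)
    (hS : Integrable (fun p => p.2.2) ν)
    (hE : ∫⁻ p, energyE d γ p ∂ν ≠ ⊤) :
    0 < ∫ p, p.1 ∂ν ∧
    energyE d γ (∫ p, p.1 ∂ν, ∫ p, p.2.1 ∂ν, ∫ p, p.2.2 ∂ν) ≤ ∫⁻ p, energyE d γ p ∂ν ∧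
    (∫⁻ p, energyE d γ p ∂ν ≤ energyE d γ (∫ p, p.1 ∂ν, ∫ p, p.2.1 ∂ν, ∫ p, p.2.2 ∂ν) →
      ν = Measure.dirac (∫ p, p.1 ∂ν, ∫ p, p.2.1 ∂ν, ∫ p, p.2.2 ∂ν)) := by
  have hae : ∀ᵐ p ∂ν, 0 < p.1 :=
    (mem_ae_iff_prob_eq_one (measurableSet_lt measurable_const measurable_fst)).2 hpos
  have hr : 0 < ∫ p, p.1 ∂ν := by
    rw [integral_pos_iff_support_of_nonneg_ae (hae.mono fun p hp => hp.le) hρ]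
    exact (hpos ▸ one_pos : 0 < ν {p | 0 < p.1}).trans_le
      (measure_mono fun p (hp : 0 < p.1) => hp.ne')
  have hEe : ∫⁻ p, energyE d γ p ∂ν = ∫⁻ p, ENNReal.ofReal (realEnergy d γ p) ∂ν :=
    lintegral_congr_ae (hae.mono fun p hp => energyE_of_pos_s9 d γ hp)
  have hnn : 0 ≤ᵐ[ν] realEnergy d γ := hae.mono fun p hp => realEnergy_nonneg d hγ hp
  have hint : Integrable (realEnergy d γ) ν :=
    (lintegral_ofReal_ne_top_iff_integrable
      (measurable_realEnergy d γ).aestronglyMeasurable hnn).1 (hEe ▸ hE)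
  set b : ℝ × EuclideanSpace ℝ (Fin d) × ℝ := (∫ p, p.1 ∂ν, ∫ p, p.2.1 ∂ν, ∫ p, p.2.2 ∂ν)
    with hb
  have hb1 : 0 < b.1 := hr
  have hT := integrable_energyTangent γ b hρ hm hS
  have hTint : ∫ p, energyTangent d γ b p ∂ν = realEnergy d γ b := by
    rw [integral_energyTangent γ b hρ hm hS, ← hb, energyTangent_self d γ hb1]
  have hle : energyTangent d γ b ≤ᵐ[ν] realEnergy d γ :=
    hae.mono fun p hp => energyTangent_le_realEnergy d hγ hb1 hp
  rw [hEe, energyE_of_pos_s9 d γ hb1, ← ofReal_integral_eq_lintegral_ofReal hint hnn, ← hTint]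
  refine ⟨hr, ENNReal.ofReal_le_ofReal (integral_mono_ae hT hint hle), fun h => ?_⟩
  have hge : ∫ p, realEnergy d γ p ∂ν ≤ ∫ p, energyTangent d γ b p ∂ν :=
    (ENNReal.ofReal_le_ofReal_iff (hTint ▸ realEnergy_nonneg d hγ hb1)).1 h
  have heq := (integral_eq_iff_of_ae_le hT hint hle).1
    (le_antisymm (integral_mono_ae hT hint hle) hge)
  refine eq_dirac_of_ae_eq ?_
  filter_upwards [heq, hae] with p hp hp0
  by_contra hne
  exact (energyTangent_lt_realEnergy d hγ hb1 hp0 hne).ne hp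
end

section
/- (Entropy adjustment with prescribed total energy.) Let (Ω, μ) be a σ-finite measure space with μ(Ω) > 0, and let ρ, S : Ω → ℝ and m : Ω → ℝ^d be measurable functions with ρ(x) > 0 for μ-a.e. x. Assume the function x ↦ E(ρ(x), m(x), S(x)) is μ-integrable, and let E₀ be a real number with E₀ > ∫_Ω E(ρ, m, S) dμ. Then there exists a measurable function S' : Ω → ℝ such that S'(x) > S(x) for μ-a.e. x and ∫_Ω E(ρ, m, S') dμ = E₀. -/
open Real MeasureTheory

/-- The total energy of the polytropic Euler system for `ρ > 0`:
`E(ρ, m, S) = |m|²/(2ρ) + (γ−1)⁻¹ ρ^γ exp((γ−1)S/ρ)`. -/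
noncomputable def totalEnergy (d : ℕ) (γ : ℝ) (ρ : ℝ) (m : EuclideanSpace ℝ (Fin d))
    (S : ℝ) : ℝ :=
  ‖m‖ ^ 2 / (2 * ρ) + (γ - 1)⁻¹ * ρ ^ γ * Real.exp ((γ - 1) * S / ρ)

/-- The internal energy density, i.e. the pressure-driven part of `totalEnergy`. -/
noncomputable def internalEnergy (γ ρ S : ℝ) : ℝ :=
  (γ - 1)⁻¹ * ρ ^ γ * Real.exp ((γ - 1) * S / ρ)

lemma internalEnergy_pos {γ ρ : ℝ} (hγ : 1 < γ) (hρ : 0 < ρ) (S : ℝ) :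
    0 < internalEnergy γ ρ S := by
  have : 0 < γ - 1 := sub_pos.2 hγ
  unfold internalEnergy
  positivity

/-- The entropy at which the total energy exceeds its value at `S` by exactly `h`. -/
noncomputable def raisedEntropy (γ ρ S h : ℝ) : ℝ :=
  S + ρ / (γ - 1) * Real.log (1 + h / internalEnergy γ ρ S)

lemma lt_raisedEntropy {γ ρ S h : ℝ} (hγ : 1 < γ) (hρ : 0 < ρ) (hh : 0 < h) :
    S < raisedEntropy γ ρ S h := by
  have hquot : 0 < h / internalEnergy γ ρ S := div_pos hh (internalEnergy_pos hγ hρ S)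
  exact lt_add_of_pos_right S
    (mul_pos (div_pos hρ (sub_pos.2 hγ)) (Real.log_pos (by linarith)))

lemma totalEnergy_raisedEntropy (d : ℕ) {γ ρ S h : ℝ} (m : EuclideanSpace ℝ (Fin d))
    (hγ : 1 < γ) (hρ : 0 < ρ) (hh : 0 < h) :
    totalEnergy d γ ρ m (raisedEntropy γ ρ S h) = totalEnergy d γ ρ m S + h := by
  have hI := internalEnergy_pos hγ hρ S
  have hγ' : γ - 1 ≠ 0 := (sub_pos.2 hγ).ne'
  have hexp : (γ - 1) * raisedEntropy γ ρ S h / ρ =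
      (γ - 1) * S / ρ + Real.log (1 + h / internalEnergy γ ρ S) := by
    unfold raisedEntropy
    field_simp
  have key : internalEnergy γ ρ (raisedEntropy γ ρ S h) = internalEnergy γ ρ S + h := by
    rw [internalEnergy, hexp, Real.exp_add, Real.exp_log (by positivity), ← mul_assoc,
      ← internalEnergy, mul_add, mul_one, mul_div_cancel₀ h hI.ne']
  change _ + internalEnergy γ ρ (raisedEntropy γ ρ S h) = _ + internalEnergy γ ρ S + h
  rw [key, add_assoc]

lemma Measurable.raisedEntropy {Ω : Type*} [MeasurableSpace Ω] {ρ S h : Ω → ℝ} (γ : ℝ)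
    (hρ : Measurable ρ) (hS : Measurable S) (hh : Measurable h) :
    Measurable fun x => raisedEntropy γ (ρ x) (S x) (h x) := by
  unfold _root_.raisedEntropy internalEnergy
  fun_prop

/-- On a nonzero σ-finite measure space every positive real is the integral of an everywhere
positive measurable function. -/
lemma exists_pos_integral_eq {Ω : Type*} [MeasurableSpace Ω] (μ : Measure Ω) [SigmaFinite μ]
    (hμ : μ Set.univ ≠ 0) {c : ℝ} (hc : 0 < c) :
    ∃ h : Ω → ℝ, Measurable h ∧ (∀ x, 0 < h x) ∧ Integrable h μ ∧ ∫ x, h x ∂μ = c := by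
  obtain ⟨g, hgpos, hgmeas, hglt⟩ := exists_pos_lintegral_lt_of_sigmaFinite μ one_ne_zero
  have hgint : Integrable (fun x => (g x : ℝ)) μ := by
    refine ⟨hgmeas.coe_nnreal_real.aestronglyMeasurable, ?_⟩
    simpa [hasFiniteIntegral_iff_enorm] using hglt.trans ENNReal.one_lt_top
  have hI : 0 < ∫ x, (g x : ℝ) ∂μ := by
    rw [integral_pos_iff_support_of_nonneg (fun x => (g x).coe_nonneg) hgint]
    have : Function.support (fun x => (g x : ℝ)) = Set.univ :=
      Set.eq_univ_of_forall fun x => (NNReal.coe_pos.2 (hgpos x)).ne'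
    rw [this]
    exact pos_iff_ne_zero.2 hμ
  refine ⟨fun x => c / (∫ y, (g y : ℝ) ∂μ) * g x, hgmeas.coe_nnreal_real.const_mul _,
    fun x => mul_pos (div_pos hc hI) (hgpos x), hgint.const_mul _, ?_⟩
  rw [integral_const_mul, div_mul_cancel₀ c hI.ne']

/-- Entropy adjustment with prescribed total energy: given a state `(ρ, m, S)` with
a.e. positive density and integrable energy, and a level `E₀` strictly above the total
energy, there is a measurable entropy `S'` pointwise a.e. strictly larger than `S`
whose associated total energy is exactly `E₀`. -/
theorem exists_entropy_adjustment (d : ℕ) (hd : 1 ≤ d) (γ : ℝ) (hγ : 1 < γ)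
    {Ω : Type*} [MeasurableSpace Ω] (μ : Measure Ω) [SigmaFinite μ]
    (hμ : μ Set.univ ≠ 0)
    (ρ : Ω → ℝ) (m : Ω → EuclideanSpace ℝ (Fin d)) (S : Ω → ℝ)
    (hρmeas : Measurable ρ) (hmmeas : Measurable m) (hSmeas : Measurable S)
    (hρpos : ∀ᵐ x ∂μ, 0 < ρ x)
    (hint : Integrable (fun x => totalEnergy d γ (ρ x) (m x) (S x)) μ)
    (E₀ : ℝ) (hE₀ : ∫ x, totalEnergy d γ (ρ x) (m x) (S x) ∂μ < E₀) :
    ∃ S' : Ω → ℝ, Measurable S' ∧ (∀ᵐ x ∂μ, S x < S' x) ∧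
      Integrable (fun x => totalEnergy d γ (ρ x) (m x) (S' x)) μ ∧
      ∫ x, totalEnergy d γ (ρ x) (m x) (S' x) ∂μ = E₀ := by
  obtain ⟨h, hmeas, hpos, hhint, hheq⟩ := exists_pos_integral_eq μ hμ (sub_pos.2 hE₀)
  have hae : (fun x => totalEnergy d γ (ρ x) (m x) (raisedEntropy γ (ρ x) (S x) (h x)))
      =ᵐ[μ] fun x => totalEnergy d γ (ρ x) (m x) (S x) + h x :=
    hρpos.mono fun x hx => totalEnergy_raisedEntropy d (m x) hγ hx (hpos x)
  refine ⟨fun x => raisedEntropy γ (ρ x) (S x) (h x),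
    Measurable.raisedEntropy γ hρmeas hSmeas hmeas,
    hρpos.mono fun x hx => lt_raisedEntropy hγ hx (hpos x),
    (hint.add hhint).congr hae.symm, ?_⟩
  rw [integral_congr_ae hae, integral_add hint hhint, hheq, add_sub_cancel]
end
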